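/- arXiv:1504.08034 — 5 statements merged into one kernel-verified Lean document; each statement's English description precedes it below -/
import Mathlib

section
/- (Proposition 1) Let 𝔽 = ℝ or ℂ, and let f and g be self-mappings of the general linear group GL_n(𝔽) such that at least one of f and g is an open map (with respect to the subspace topology GL_n(𝔽) inherits from M_n(𝔽)). Then for any matrices A, B ∈ M_n(𝔽) and any ε > 0 there exist invertible matrices A_ε and B_ε with simple spectra such that ‖A − A_ε‖ < ε, ‖B − B_ε‖ < ε, and the product matrix f(A_ε)·g(B_ε) has a simple spectrum. -/
open Polynomial in
theorem Polynomial.resultant_derivative_map {R S : Type*} [CommRing R] [IsDomain R] [CharZero R]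
    [CommRing S] [IsDomain S] [CharZero S] (φ : R →+* S) {p : R[X]} (hp : p.Monic) :
    φ (p.resultant (derivative p)) = (p.map φ).resultant (derivative (p.map φ)) := by
  rw [← resultant_map_map, ← derivative_map]
  simp only [natDegree_derivative, hp.natDegree_map φ]

open Polynomial in
theorem Polynomial.Monic.squarefree_iff_resultant_derivative_ne_zero {K : Type*} [Field K]
    [CharZero K] {p : K[X]} (hp : p.Monic) :
    Squarefree p ↔ p.resultant (derivative p) ≠ 0 := by
  rw [← isUnit_iff_ne_zero, isUnit_resultant_iff_isCoprime hp,
    ← PerfectField.separable_iff_squarefree]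
  rfl

theorem MvPolynomial.exists_mem_eval_ne_zero {K σ : Type*} [NontriviallyNormedField K]
    [Finite σ] {p : MvPolynomial σ K} (hp : p ≠ 0) {U : Set (σ → K)}
    (hU : IsOpen U) (hne : U.Nonempty) : ∃ x ∈ U, eval x p ≠ 0 := by
  obtain ⟨x, hx⟩ := hne
  have hmem : U ∈ nhds x := hU.mem_nhds hx
  rw [nhds_pi, Filter.mem_pi] at hmem
  obtain ⟨I, -, t, ht, htU⟩ := hmem
  by_contra! h
  refine hp (MvPolynomial.funext_set t (fun i ↦ infinite_of_mem_nhds (x i) (ht i)) fun y hy ↦ ?_)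
  rw [h y (htU fun i _ ↦ hy i trivial), map_zero]

namespace Matrix

/-- The product of the determinant and the resultant of the characteristic polynomial with its
derivative, as a polynomial in the entries of a square matrix. -/
noncomputable def detMulDiscrPoly (K n : Type*) [Field K] [Fintype n] [DecidableEq n] :
    MvPolynomial (n × n) K :=
  (mvPolynomialX n n K).det *
    (charpoly.univ K n).resultant (Polynomial.derivative (charpoly.univ K n))

theorem isOpen_setOf_isUnit (K n : Type*) [NontriviallyNormedField K] [Fintype n]
    [DecidableEq n] : IsOpen {M : Matrix n n K | IsUnit M} := by
  simp_rw [isUnit_iff_isUnit_det, isUnit_iff_ne_zero]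
  exact isOpen_ne.preimage continuous_id.matrix_det

section CharZero

variable {K n : Type*} [Field K] [CharZero K] [Fintype n] [DecidableEq n]

theorem eval_detMulDiscrPoly_ne_zero_iff (M : Matrix n n K) :
    MvPolynomial.eval (fun ij : n × n ↦ M ij.1 ij.2) (detMulDiscrPoly K n) ≠ 0 ↔
      IsUnit M ∧ Squarefree M.charpoly := by
  have hmap : (charpoly.univ K n).map (MvPolynomial.eval fun ij : n × n ↦ M ij.1 ij.2) =
      M.charpoly := charpoly.univ_map_eval₂Hom n (RingHom.id K) _
  rw [detMulDiscrPoly, map_mul, mul_ne_zero_iff, RingHom.map_det,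
    Polynomial.resultant_derivative_map _ (charpoly.univ_monic K n), hmap,
    ← M.charpoly_monic.squarefree_iff_resultant_derivative_ne_zero, isUnit_iff_isUnit_det,
    isUnit_iff_ne_zero, mvPolynomialX_mapMatrix_eval]

theorem squarefree_charpoly_diagonal {d : n → K} (hd : Function.Injective d) :
    Squarefree (diagonal d).charpoly := by
  rw [charpoly_diagonal, ← PerfectField.separable_iff_squarefree]
  exact Polynomial.separable_prod_X_sub_C_iff.2 hd

variable (K n) in
theorem detMulDiscrPoly_ne_zero : detMulDiscrPoly K n ≠ 0 := by
  intro h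
  let e := Fintype.equivFin n
  let d : n → K := fun i ↦ ((e i : ℕ) : K) + 1
  have hd : Function.Injective d := fun i j hij ↦ by
    simpa [d, Fin.val_inj] using hij
  have hunit : IsUnit (diagonal d) := by
    rw [isUnit_diagonal, Pi.isUnit_iff]
    exact fun i ↦ (Nat.cast_add_one_ne_zero (R := K) (e i)).isUnit
  exact (eval_detMulDiscrPoly_ne_zero_iff (diagonal d)).2
    ⟨hunit, squarefree_charpoly_diagonal hd⟩ (by rw [h, map_zero])

end CharZero

variable {K n : Type*} [NontriviallyNormedField K] [CharZero K] [Fintype n] [DecidableEq n]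

variable (K n) in
theorem isOpen_setOf_isUnit_and_squarefree_charpoly :
    IsOpen {M : Matrix n n K | IsUnit M ∧ Squarefree M.charpoly} := by
  simp_rw [← eval_detMulDiscrPoly_ne_zero_iff]
  refine isOpen_ne.preimage ((MvPolynomial.continuous_eval _).comp ?_)
  exact continuous_pi fun ij ↦ continuous_id.matrix_elem ij.1 ij.2

theorem exists_mem_isUnit_and_squarefree_charpoly {U : Set (Matrix n n K)} (hU : IsOpen U)
    (hne : U.Nonempty) : ∃ M ∈ U, IsUnit M ∧ Squarefree M.charpoly := by
  have hcont : Continuous fun x : n × n → K ↦ of fun i j ↦ x (i, j) :=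
    continuous_matrix fun i j ↦ continuous_apply (i, j)
  obtain ⟨M₀, hM₀⟩ := hne
  obtain ⟨x, hxU, hx⟩ := MvPolynomial.exists_mem_eval_ne_zero (detMulDiscrPoly_ne_zero K n)
    (hU.preimage hcont) ⟨fun ij ↦ M₀ ij.1 ij.2, hM₀⟩
  exact ⟨_, hxU, (eval_detMulDiscrPoly_ne_zero_iff (of fun i j ↦ x (i, j))).1 hx⟩

theorem exists_mem_squarefree_charpoly_mul {U : Set {M : Matrix n n K // IsUnit M}}
    (hU : IsOpen U) (hne : U.Nonempty) {C : Matrix n n K} (hC : IsUnit C) :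
    ∃ M ∈ U, Squarefree ((M : Matrix n n K) * C).charpoly := by
  obtain ⟨C, rfl⟩ := hC
  have hcont : Continuous fun M : Matrix n n K ↦ M * (↑C⁻¹ : Matrix n n K) :=
    continuous_id.matrix_mul continuous_const
  have hU' := ((isOpen_setOf_isUnit K n).isOpenMap_subtype_val U hU).preimage hcont
  obtain ⟨M, ⟨N, hN, hNM⟩, -, hM⟩ := exists_mem_isUnit_and_squarefree_charpoly hU' <| by
    obtain ⟨M₀, hM₀⟩ := hne
    exact ⟨M₀ * C, M₀, hM₀, by simp⟩
  refine ⟨N, hN, ?_⟩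
  rwa [hNM, Units.inv_mul_cancel_right]

theorem exists_squarefree_charpoly_mul_of_isOpenMap
    {f g : {M : Matrix n n K // IsUnit M} → {M : Matrix n n K // IsUnit M}} (hf : IsOpenMap f)
    {U V : Set (Matrix n n K)} (hU : IsOpen U) (hUne : U.Nonempty)
    (hV : IsOpen V) (hVne : V.Nonempty) :
    ∃ A B : {M : Matrix n n K // IsUnit M}, (A : Matrix n n K) ∈ U ∧ (B : Matrix n n K) ∈ V ∧
      Squarefree (A : Matrix n n K).charpoly ∧ Squarefree (B : Matrix n n K).charpoly ∧
      Squarefree ((f A : Matrix n n K) * (g B : Matrix n n K)).charpoly := by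
  obtain ⟨B, hBV, hB, hBs⟩ := exists_mem_isUnit_and_squarefree_charpoly hV hVne
  obtain ⟨A₀, hA₀U, hA₀, hA₀s⟩ := exists_mem_isUnit_and_squarefree_charpoly hU hUne
  have hW := (hU.inter (isOpen_setOf_isUnit_and_squarefree_charpoly K n)).preimage
    (continuous_subtype_val (p := fun M : Matrix n n K ↦ IsUnit M))
  obtain ⟨-, ⟨A, ⟨hAU, -, hAs⟩, rfl⟩, hA⟩ := exists_mem_squarefree_charpoly_mul (hf _ hW)
    ⟨f ⟨A₀, hA₀⟩, Set.mem_image_of_mem f ⟨hA₀U, hA₀, hA₀s⟩⟩ (g ⟨B, hB⟩).2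
  exact ⟨A, ⟨B, hB⟩, hAU, hBV, hAs, hBs, hA⟩

end Matrix

attribute [local instance] Matrix.normedAddCommGroup

/-- Proposition 1: if `f` and `g` are self-maps of `GL_n(𝕜)` (viewed as the subtype of
invertible matrices with the subspace topology) and at least one of them is an open map,
then any pair of matrices `A, B` can be `ε`-approximated by invertible matrices `Aε, Bε`
with simple spectra such that `f Aε * g Bε` also has a simple spectrum. -/
theorem exists_simpleSpectrum_pair_of_openMap {𝕜 : Type*} [RCLike 𝕜] (n : ℕ)
    (f g : {M : Matrix (Fin n) (Fin n) 𝕜 // IsUnit M} → {M : Matrix (Fin n) (Fin n) 𝕜 // IsUnit M})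
    (hfg : IsOpenMap f ∨ IsOpenMap g)
    (A B : Matrix (Fin n) (Fin n) 𝕜) (ε : ℝ) (hε : 0 < ε) :
    ∃ (Aε Bε : {M : Matrix (Fin n) (Fin n) 𝕜 // IsUnit M}),
      Squarefree (Aε : Matrix (Fin n) (Fin n) 𝕜).charpoly ∧
      Squarefree (Bε : Matrix (Fin n) (Fin n) 𝕜).charpoly ∧
      ‖A - (Aε : Matrix (Fin n) (Fin n) 𝕜)‖ < ε ∧
      ‖B - (Bε : Matrix (Fin n) (Fin n) 𝕜)‖ < ε ∧
      Squarefree ((f Aε : Matrix (Fin n) (Fin n) 𝕜) * (g Bε : Matrix (Fin n) (Fin n) 𝕜)).charpoly := by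
  have hopen (M : Matrix (Fin n) (Fin n) 𝕜) : IsOpen {N | ‖M - N‖ < ε} :=
    isOpen_lt (continuous_const.sub continuous_id).norm continuous_const
  have hne (M : Matrix (Fin n) (Fin n) 𝕜) : {N | ‖M - N‖ < ε}.Nonempty := ⟨M, by simpa using hε⟩
  rcases hfg with hf | hg
  · obtain ⟨A', B', hA, hB, hAs, hBs, h⟩ := Matrix.exists_squarefree_charpoly_mul_of_isOpenMap
      (g := g) hf (hopen A) (hne A) (hopen B) (hne B)
    exact ⟨A', B', hAs, hBs, hA, hB, h⟩
  · obtain ⟨B', A', hB, hA, hBs, hAs, h⟩ := Matrix.exists_squarefree_charpoly_mul_of_isOpenMap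
      (g := f) hg (hopen B) (hne B) (hopen A) (hne A)
    exact ⟨A', B', hAs, hBs, hA, hB, by rwa [Matrix.charpoly_mul_comm]⟩
end

section
/- (Proposition 2) Let 𝔽 = ℝ or ℂ and let A, B ∈ M_n(𝔽). Then for any ε > 0 there exist invertible matrices A_ε and B_ε with simple spectra such that ‖A − A_ε‖ < ε, ‖B − B_ε‖ < ε, and the product matrix A_ε·B_ε⁻¹ has a simple spectrum. -/
attribute [local instance] Matrix.normedAddCommGroup

open Polynomial Filter Topology

/-- A monic family of polynomials over a field of characteristic zero has a discriminant in the
parameter that detects squarefreeness of the members of the family. -/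
lemma Polynomial.exists_eval_ne_zero_iff_squarefree_map {K : Type*} [Field K] [CharZero K]
    {P : K[X][X]} (hP : P.Monic) :
    ∃ r : K[X], ∀ s : K, r.eval s ≠ 0 ↔ Squarefree (P.map (evalRingHom s)) := by
  refine ⟨resultant P (derivative P), fun s => ?_⟩
  have hne : P.map (evalRingHom s) ≠ 0 := (hP.map _).ne_zero
  have key : resultant (P.map (evalRingHom s)) (derivative (P.map (evalRingHom s))) =
      (resultant P (derivative P)).eval s := by
    rw [natDegree_derivative, hP.natDegree_map, derivative_map, natDegree_derivative,
      resultant_map_map]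
    simp
  rw [← key, Ne, resultant_eq_zero_iff, ← PerfectField.separable_iff_squarefree, Separable]
  tauto

lemma Polynomial.eventually_eval_ne_zero {𝕜 : Type*} [NormedField 𝕜] {r : 𝕜[X]} (hr : r ≠ 0)
    (a : 𝕜) : ∀ᶠ s in 𝓝[≠] a, r.eval s ≠ 0 := by
  have hfin : ({s | r.IsRoot s} \ {a}).Finite := (finite_setOfPred_isRoot hr).sdiff
  rw [eventually_nhdsWithin_iff]
  filter_upwards [hfin.isClosed.compl_mem_nhds (by simp)] with s hs hsa h0
  exact hs ⟨h0, hsa⟩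

/-- If one member of a polynomial family of matrices has squarefree characteristic polynomial, then
so do all members with parameter close to, but different from, a given one. -/
lemma Matrix.eventually_squarefree_charpoly {𝕜 n : Type*} [RCLike 𝕜] [Fintype n] [DecidableEq n]
    (M : Matrix n n 𝕜[X]) {s₀ : 𝕜} (h : Squarefree (M.map (eval s₀)).charpoly) (a : 𝕜) :
    ∀ᶠ s in 𝓝[≠] a, Squarefree (M.map (eval s)).charpoly := by
  obtain ⟨r, hr⟩ := exists_eval_ne_zero_iff_squarefree_map M.charpoly_monic
  have hr' (s : 𝕜) : r.eval s ≠ 0 ↔ Squarefree (M.map (eval s)).charpoly := by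
    rw [hr, ← Matrix.charpoly_map]; rfl
  have hr0 : r ≠ 0 := by
    rintro rfl
    simpa using (hr' s₀).2 h
  filter_upwards [eventually_eval_ne_zero hr0 a] with s hs using (hr' s).1 hs

lemma Matrix.squarefree_charpoly_smul {K n : Type*} [Field K] [Fintype n] [DecidableEq n]
    {M : Matrix n n K} (hM : Squarefree M.charpoly) {c : K} (hc : c ≠ 0) :
    Squarefree (c • M).charpoly := by
  have key : (c • M).charpoly.comp (C c * X) = C (c ^ Fintype.card n) * M.charpoly := by
    rw [Matrix.charpoly, Matrix.charpoly, ← coe_compRingHom_apply, RingHom.map_det, C_pow,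
      ← Matrix.det_smul]
    congr 1
    ext i j : 1
    by_cases h : i = j
    · subst h; simp [mul_sub]
    · simp [h]
  have hu : IsUnit (C (c ^ Fintype.card n) : K[X]) := isUnit_C.2 (pow_ne_zero _ hc).isUnit
  intro x ⟨y, hy⟩
  have h1 : x.comp (C c * X) * x.comp (C c * X) ∣ M.charpoly := by
    rw [← hu.dvd_mul_left, ← key, hy]
    exact ⟨y.comp (C c * X), by simp⟩
  have h2 := hM _ h1
  have h3 : IsUnit ((x.comp (C c * X)).comp (C c⁻¹ * X)) := by
    rw [← coe_compRingHom_apply (x.comp _)]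
    exact h2.map _
  rwa [comp_assoc, mul_comp, C_comp, X_comp, ← mul_assoc, ← C_mul, mul_inv_cancel₀ hc, C_1, one_mul,
    comp_X] at h3

lemma Matrix.squarefree_charpoly_diagonal_s3 {K n : Type*} [Field K] [Fintype n] [DecidableEq n]
    {d : n → K} (hd : Function.Injective d) : Squarefree (Matrix.diagonal d).charpoly := by
  rw [Matrix.charpoly_diagonal]
  exact (separable_prod_X_sub_C_iff.2 hd).squarefree

/-- Proposition 2: any pair of matrices `A, B ∈ M_n(𝕜)` (`𝕜 = ℝ` or `ℂ`) can be
`ε`-approximated by invertible matrices `Aε, Bε` with simple spectra such that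
`Aε * Bε⁻¹` also has a simple spectrum. -/
theorem exists_simpleSpectrum_mul_inv_right {𝕜 : Type*} [RCLike 𝕜] (n : ℕ)
    (A B : Matrix (Fin n) (Fin n) 𝕜) (ε : ℝ) (hε : 0 < ε) :
    ∃ Aε Bε : Matrix (Fin n) (Fin n) 𝕜,
      IsUnit Aε ∧ IsUnit Bε ∧
      Squarefree Aε.charpoly ∧ Squarefree Bε.charpoly ∧
      ‖A - Aε‖ < ε ∧ ‖B - Bε‖ < ε ∧
      Squarefree (Aε * Bε⁻¹).charpoly := by
  let d : Fin n → 𝕜 := fun i => ((i : ℕ) : 𝕜) + 1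
  have hd0 (i) : d i ≠ 0 := Nat.cast_add_one_ne_zero _
  have hd : Function.Injective d := fun i j h => by simpa [d, Fin.ext_iff] using h
  have hd2 : Function.Injective fun i => d i * d i := fun i j h => by
    have h' : ((i : ℕ) + 1) * ((i : ℕ) + 1) = ((j : ℕ) + 1) * ((j : ℕ) + 1) := by
      have h : (((i : ℕ) : 𝕜) + 1) * (((i : ℕ) : 𝕜) + 1) =
          (((j : ℕ) : 𝕜) + 1) * (((j : ℕ) : 𝕜) + 1) := h
      exact_mod_cast h
    have := Nat.mul_self_inj.1 h'
    exact Fin.ext (by omega)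
  let D₁ : Matrix (Fin n) (Fin n) 𝕜 := Matrix.diagonal fun i => d i * d i
  let D₂ : Matrix (Fin n) (Fin n) 𝕜 := Matrix.diagonal d
  let L (M D : Matrix (Fin n) (Fin n) 𝕜) : Matrix (Fin n) (Fin n) 𝕜[X] :=
    M.map C + (X : 𝕜[X]) • (D - M).map C
  have hL (M D) (s : 𝕜) : (L M D).map (eval s) = M + s • (D - M) := by
    ext i j; simp [L]
  have hL1 (M D) : (L M D).map (eval 1) = D := by simp [hL]
  have hadj (s : 𝕜) : ((L B D₂).adjugate).map (eval s) = ((L B D₂).map (eval s)).adjugate :=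
    (evalRingHom s).map_adjugate _
  have hmul (s : 𝕜) : (L A D₁ * (L B D₂).adjugate).map (eval s) =
      (L A D₁).map (eval s) * ((L B D₂).map (eval s)).adjugate := by
    rw [← hadj]
    exact Matrix.map_mul (f := evalRingHom s)
  have hdet (M D) (hD : D.det ≠ 0) :
      ∀ᶠ s in 𝓝[≠] (0 : 𝕜), ((L M D).map (eval s)).det ≠ 0 := by
    have h (s : 𝕜) : (L M D).det.eval s = ((L M D).map (eval s)).det :=
      (evalRingHom s).map_det _
    have h0 : (L M D).det ≠ 0 := fun h0 => hD (by rw [← hL1 M D, ← h, h0, eval_zero])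
    simpa only [h] using eventually_eval_ne_zero h0 0
  have hnorm (M D) : ∀ᶠ s in 𝓝[≠] (0 : 𝕜), ‖M - (L M D).map (eval s)‖ < ε := by
    have hc : Continuous fun s : 𝕜 => ‖M - (M + s • (D - M))‖ := by fun_prop
    simp only [hL]
    refine nhdsWithin_le_nhds (hc.tendsto 0 |>.eventually_lt_const ?_)
    simpa using hε
  have hD₁ : D₁.det ≠ 0 := by
    simp [D₁, Matrix.det_diagonal, Finset.prod_ne_zero_iff, hd0]
  have hD₂ : D₂.det ≠ 0 := by
    simp [D₂, Matrix.det_diagonal, Finset.prod_ne_zero_iff, hd0]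
  have hD : Squarefree (D₁ * D₂.adjugate).charpoly := by
    have h : D₁ * D₂.adjugate = D₂.det • D₂ := by
      have h' : D₁ = D₂ * D₂ := (Matrix.diagonal_mul_diagonal _ _).symm
      rw [h', mul_assoc, Matrix.mul_adjugate, mul_smul_comm, mul_one]
    rw [h]
    exact Matrix.squarefree_charpoly_smul (Matrix.squarefree_charpoly_diagonal_s3 hd) hD₂
  have hsfA := Matrix.eventually_squarefree_charpoly (L A D₁) (s₀ := 1)
    (by rw [hL1]; exact Matrix.squarefree_charpoly_diagonal_s3 hd2) 0
  have hsfB := Matrix.eventually_squarefree_charpoly (L B D₂) (s₀ := 1)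
    (by rw [hL1]; exact Matrix.squarefree_charpoly_diagonal_s3 hd) 0
  have hsfAB := Matrix.eventually_squarefree_charpoly (L A D₁ * (L B D₂).adjugate) (s₀ := 1)
    (by rw [hmul, hL1, hL1]; exact hD) 0
  obtain ⟨s, hA, hB, hAs, hBs, hAn, hBn, hAB⟩ := ((hdet A D₁ hD₁).and <| (hdet B D₂ hD₂).and <|
    hsfA.and <| hsfB.and <| (hnorm A D₁).and <| (hnorm B D₂).and hsfAB).exists
  refine ⟨_, _, (Matrix.isUnit_iff_isUnit_det _).2 hA.isUnit,
    (Matrix.isUnit_iff_isUnit_det _).2 hB.isUnit, hAs, hBs, hAn, hBn, ?_⟩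
  rw [Matrix.inv_def, mul_smul_comm, ← hmul, Ring.inverse_eq_inv']
  exact Matrix.squarefree_charpoly_smul hAB (inv_ne_zero hB)
end

section
/- (Variant of Proposition 2 with the inverse on the left) Let 𝔽 = ℝ or ℂ and let A, B ∈ M_n(𝔽). Then for any ε > 0 there exist invertible matrices A_ε and B_ε with simple spectra such that ‖A − A_ε‖ < ε, ‖B − B_ε‖ < ε, and the product matrix A_ε⁻¹·B_ε has a simple spectrum. -/
attribute [local instance] Matrix.normedAddCommGroup

open Polynomial Filter Topology

/-- A polynomial over a topological field which does not vanish identically has no zeros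
in a punctured neighbourhood of any point. -/
lemma Polynomial.eventually_eval_ne_zero_s4 {K : Type*} [Field K] [TopologicalSpace K] [T1Space K]
    {p : K[X]} (hp : p ≠ 0) (a : K) : ∀ᶠ t in 𝓝[≠] a, p.eval t ≠ 0 := by
  have h := ((p.rootSet_finite K).subset (Set.sdiff_subset (t := {a}))).isClosed.compl_mem_nhds
    (x := a) (by simp)
  filter_upwards [mem_nhdsWithin_of_mem_nhds h, self_mem_nhdsWithin] with t ht hta h0
  exact ht ⟨(mem_rootSet_of_ne hp).2 (by simpa using h0), hta⟩

/-- Over a field of characteristic zero, a matrix of size `n` has squarefree characteristic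
polynomial iff the resultant of that polynomial and its derivative is nonzero. -/
lemma Matrix.squarefree_charpoly_iff_resultant_ne_zero {K : Type*} [Field K] [CharZero K] {n : ℕ}
    (M : Matrix (Fin n) (Fin n) K) :
    Squarefree M.charpoly ↔ resultant M.charpoly (derivative M.charpoly) n (n - 1) ≠ 0 := by
  have h1 : M.charpoly.natDegree = n := by simp
  have h2 : (derivative M.charpoly).natDegree = n - 1 := by rw [natDegree_derivative, h1]
  have h3 := resultant_eq_zero_iff (f := M.charpoly) (g := derivative M.charpoly)
  rw [h1, h2] at h3
  rw [← PerfectField.separable_iff_squarefree, Ne, h3, Polynomial.Separable]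
  simp [M.charpoly_monic.ne_zero]

/-- The line through two matrices, as a matrix of polynomials. -/
noncomputable def Matrix.polyLine {K : Type*} [CommRing K] {n : ℕ}
    (A B : Matrix (Fin n) (Fin n) K) : Matrix (Fin n) (Fin n) K[X] :=
  A.map C + (X : K[X]) • (B - A).map C

lemma Matrix.polyLine_map_eval {K : Type*} [CommRing K] {n : ℕ}
    (A B : Matrix (Fin n) (Fin n) K) (t : K) :
    (polyLine A B).map (evalRingHom t) = A + t • (B - A) := by
  ext i j
  simp [polyLine]

/-- If some matrix on a line is invertible, then so are all matrices on the line close to, but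
different from, the base point. -/
lemma Matrix.eventually_isUnit_line {K : Type*} [Field K] [TopologicalSpace K] [T1Space K] {n : ℕ}
    (A B : Matrix (Fin n) (Fin n) K) {s : K} (hs : IsUnit (A + s • (B - A))) :
    ∀ᶠ t in 𝓝[≠] (0 : K), IsUnit (A + t • (B - A)) := by
  have key (t : K) : IsUnit (A + t • (B - A)) ↔ (polyLine A B).det.eval t ≠ 0 := by
    rw [isUnit_iff_isUnit_det, isUnit_iff_ne_zero, ← polyLine_map_eval, ← coe_evalRingHom,
      RingHom.map_det, RingHom.mapMatrix_apply]
  simp only [key] at hs ⊢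
  exact eventually_eval_ne_zero_s4 (fun h ↦ hs (by simp [h])) 0

/-- If some matrix on a line has simple spectrum, then so do all matrices on the line close to, but
different from, the base point. -/
lemma Matrix.eventually_squarefree_charpoly_line {K : Type*} [Field K] [CharZero K]
    [TopologicalSpace K] [T1Space K] {n : ℕ} (A B : Matrix (Fin n) (Fin n) K) {s : K}
    (hs : Squarefree (A + s • (B - A)).charpoly) :
    ∀ᶠ t in 𝓝[≠] (0 : K), Squarefree (A + t • (B - A)).charpoly := by
  have key (t : K) : Squarefree (A + t • (B - A)).charpoly ↔
      (resultant (polyLine A B).charpoly (derivative (polyLine A B).charpoly) n (n - 1)).eval t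
        ≠ 0 := by
    rw [squarefree_charpoly_iff_resultant_ne_zero, ← polyLine_map_eval, charpoly_map,
      derivative_map, resultant_map_map, coe_evalRingHom]
  simp only [key] at hs ⊢
  exact eventually_eval_ne_zero_s4 (fun h ↦ hs (by simp [h])) 0

/-- Over a field of characteristic zero there is an invertible matrix with simple spectrum. -/
lemma Matrix.exists_isUnit_squarefree_charpoly (K : Type*) [Field K] [CharZero K] (n : ℕ) :
    ∃ D : Matrix (Fin n) (Fin n) K, IsUnit D ∧ Squarefree D.charpoly := by
  refine ⟨diagonal fun i ↦ ((i : ℕ) : K) + 1, ?_, ?_⟩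
  · rw [isUnit_iff_isUnit_det, det_diagonal, isUnit_iff_ne_zero, Finset.prod_ne_zero_iff]
    exact fun i _ ↦ Nat.cast_add_one_ne_zero _
  · rw [charpoly_diagonal]
    refine (separable_prod_X_sub_C_iff.2 fun i j h ↦ ?_).squarefree
    simpa [Fin.ext_iff] using h

lemma eventually_norm_sub_line_lt {𝕜 E : Type*} [NontriviallyNormedField 𝕜]
    [SeminormedAddCommGroup E] [NormedSpace 𝕜 E] (A B : E) {ε : ℝ} (hε : 0 < ε) :
    ∀ᶠ t in 𝓝[≠] (0 : 𝕜), ‖A - (A + t • (B - A))‖ < ε := by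
  have h : Continuous fun t : 𝕜 ↦ ‖A - (A + t • (B - A))‖ := by fun_prop
  exact (h.continuousAt.eventually_lt_const (by simpa using hε)).filter_mono nhdsWithin_le_nhds

/-- Invertible matrices with simple spectrum are dense. -/
lemma Matrix.exists_isUnit_squarefree_charpoly_norm_sub_lt {𝕜 : Type*} [RCLike 𝕜] {n : ℕ}
    (A : Matrix (Fin n) (Fin n) 𝕜) {ε : ℝ} (hε : 0 < ε) :
    ∃ A' : Matrix (Fin n) (Fin n) 𝕜, IsUnit A' ∧ Squarefree A'.charpoly ∧ ‖A - A'‖ < ε := by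
  let := Matrix.normedSpace (R := 𝕜) (α := 𝕜) (m := Fin n) (n := Fin n)
  obtain ⟨D, hD, hD'⟩ := exists_isUnit_squarefree_charpoly 𝕜 n
  obtain ⟨t, h⟩ := ((eventually_isUnit_line A D (s := 1) (by simpa using hD)).and
    ((eventually_squarefree_charpoly_line A D (s := 1) (by simpa using hD')).and
      (eventually_norm_sub_line_lt A D hε))).exists
  exact ⟨_, h⟩

/-- Variant of Proposition 2 (inverse on the left): any pair of matrices `A, B ∈ M_n(𝕜)` (`𝕜 = ℝ` or `ℂ`) can be
`ε`-approximated by invertible matrices `Aε, Bε` with simple spectra such that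
`Aε⁻¹ * Bε` also has a simple spectrum. -/
theorem exists_simpleSpectrum_inv_mul_left {𝕜 : Type*} [RCLike 𝕜] (n : ℕ)
    (A B : Matrix (Fin n) (Fin n) 𝕜) (ε : ℝ) (hε : 0 < ε) :
    ∃ Aε Bε : Matrix (Fin n) (Fin n) 𝕜,
      IsUnit Aε ∧ IsUnit Bε ∧
      Squarefree Aε.charpoly ∧ Squarefree Bε.charpoly ∧
      ‖A - Aε‖ < ε ∧ ‖B - Bε‖ < ε ∧
      Squarefree (Aε⁻¹ * Bε).charpoly := by
  let := Matrix.normedSpace (R := 𝕜) (α := 𝕜) (m := Fin n) (n := Fin n)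
  obtain ⟨A', hA, hA', hAε⟩ := A.exists_isUnit_squarefree_charpoly_norm_sub_lt hε
  obtain ⟨B', hB, hB', hBε⟩ := B.exists_isUnit_squarefree_charpoly_norm_sub_lt (half_pos hε)
  obtain ⟨D, -, hD⟩ := Matrix.exists_isUnit_squarefree_charpoly 𝕜 n
  have hdet : IsUnit A'.det := (Matrix.isUnit_iff_isUnit_det A').1 hA
  obtain ⟨t, h₁, h₂, h₃, h₄⟩ :=
    ((Matrix.eventually_isUnit_line B' (A' * D) (s := 0) (by simpa using hB)).and
    ((Matrix.eventually_squarefree_charpoly_line B' (A' * D) (s := 0) (by simpa using hB')).and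
    ((Matrix.eventually_squarefree_charpoly_line (A'⁻¹ * B') D (s := 1) (by simpa using hD)).and
      (eventually_norm_sub_line_lt B' (A' * D) (half_pos hε))))).exists
  refine ⟨A', B' + t • (A' * D - B'), hA, h₁, hA', h₂, hAε, ?_, ?_⟩
  · calc ‖B - (B' + t • (A' * D - B'))‖
        ≤ ‖B - B'‖ + ‖B' - (B' + t • (A' * D - B'))‖ := norm_sub_le_norm_sub_add_norm_sub _ _ _
      _ < ε := by linarith
  · rwa [Matrix.mul_add, Matrix.mul_smul, Matrix.mul_sub,
      Matrix.nonsing_inv_mul_cancel_left _ _ hdet]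
end

section
/- (Proposition 3) Let 𝔽 = ℝ or ℂ, let k ≥ 1, and let f₁, f₂, …, f_k be self-mappings of the general linear group GL_n(𝔽) such that at least one of them is an open map (with respect to the subspace topology GL_n(𝔽) inherits from M_n(𝔽)). Let A₁, A₂, …, A_k ∈ M_n(𝔽). Then for any ε > 0 there exist invertible matrices A₁ε, A₂ε, …, A_kε, each having a simple spectrum, such that ‖A_i − A_iε‖ < ε for every i = 1, …, k, and the product matrix f₁(A₁ε)·f₂(A₂ε)·…·f_k(A_kε) has a simple spectrum. -/
attribute [local instance] Matrix.normedAddCommGroup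

/-- A matrix is invertible with squarefree characteristic polynomial iff a fixed polynomial in its
entries does not vanish. -/
theorem exists_mvPolynomial_eval_ne_zero_iff {ι 𝕜 : Type*} [Fintype ι] [DecidableEq ι]
    [Field 𝕜] [CharZero 𝕜] :
    ∃ P : MvPolynomial (ι × ι) 𝕜, ∀ M : Matrix ι ι 𝕜,
      MvPolynomial.eval (fun p => M p.1 p.2) P ≠ 0 ↔ IsUnit M ∧ Squarefree M.charpoly := by
  let Q := (Matrix.mvPolynomialX ι ι 𝕜).charpoly
  refine ⟨(Matrix.mvPolynomialX ι ι 𝕜).det *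
    Q.resultant Q.derivative (Fintype.card ι) (Fintype.card ι - 1), fun M => ?_⟩
  have hM := Matrix.mvPolynomialX_mapMatrix_eval M
  have hQ : Q.map (MvPolynomial.eval fun p : ι × ι => M p.1 p.2) = M.charpoly := by
    rw [← Matrix.charpoly_map, ← RingHom.mapMatrix_apply, hM]
  have hdeg : M.charpoly.derivative.natDegree = Fintype.card ι - 1 := by
    rw [Polynomial.natDegree_derivative, M.charpoly_natDegree_eq_dim]
  have hres : M.charpoly.resultant M.charpoly.derivative (Fintype.card ι) (Fintype.card ι - 1) = 0 ↔
      ¬ Squarefree M.charpoly := by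
    rw [← hdeg, ← M.charpoly_natDegree_eq_dim, Polynomial.resultant_eq_zero_iff,
      ← PerfectField.separable_iff_squarefree, Polynomial.Separable,
      and_iff_right (Or.inl M.charpoly_monic.ne_zero)]
  rw [map_mul, mul_ne_zero_iff, RingHom.map_det, hM, ← Polynomial.resultant_map_map,
    ← Polynomial.derivative_map, hQ, ne_eq _ (0 : 𝕜), ne_eq _ (0 : 𝕜), hres, not_not,
    Matrix.isUnit_iff_isUnit_det, isUnit_iff_ne_zero]

theorem exists_isUnit_and_squarefree_charpoly {𝕜 : Type*} [Field 𝕜] [CharZero 𝕜] (n : ℕ) :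
    ∃ M : Matrix (Fin n) (Fin n) 𝕜, IsUnit M ∧ Squarefree M.charpoly := by
  refine ⟨Matrix.diagonal fun i => (i : 𝕜) + 1, ?_, ?_⟩
  · rw [Matrix.isUnit_diagonal, Pi.isUnit_iff]
    exact fun i => (Nat.cast_add_one_ne_zero (i : ℕ)).isUnit
  · rw [Matrix.charpoly_diagonal]
    refine (Polynomial.separable_prod_X_sub_C_iff.2 fun i j h => ?_).squarefree
    simpa [Fin.ext_iff] using h

/-- The nonvanishing locus of a polynomial is dense as soon as it is nonempty. -/
theorem dense_setOf_mvPolynomial_eval_ne_zero {σ 𝕜 : Type*} [Fintype σ] [RCLike 𝕜]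
    (P : MvPolynomial σ 𝕜) {y : σ → 𝕜} (hy : MvPolynomial.eval y P ≠ 0) :
    Dense {x : σ → 𝕜 | MvPolynomial.eval x P ≠ 0} := by
  intro x
  rw [mem_closure_iff_frequently]
  intro hx
  refine hy (congrFun ((AnalyticOnNhd.eval_mvPolynomial P).eq_of_eventuallyEq (g := fun _ => 0)
    analyticOnNhd_const (z₀ := x) ?_) y)
  filter_upwards [hx] with z hz
  simpa using hz

/-- The invertible matrices with simple spectrum form an open dense set. -/
theorem isOpen_and_dense_setOf_isUnit_and_squarefree_charpoly (𝕜 : Type*) [RCLike 𝕜] (n : ℕ) :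
    IsOpen {M : Matrix (Fin n) (Fin n) 𝕜 | IsUnit M ∧ Squarefree M.charpoly} ∧
      Dense {M : Matrix (Fin n) (Fin n) 𝕜 | IsUnit M ∧ Squarefree M.charpoly} := by
  obtain ⟨P, hP⟩ := exists_mvPolynomial_eval_ne_zero_iff (ι := Fin n) (𝕜 := 𝕜)
  obtain ⟨D, hD⟩ := exists_isUnit_and_squarefree_charpoly (𝕜 := 𝕜) n
  simp_rw [← hP]
  have hcont : Continuous fun (M : Matrix (Fin n) (Fin n) 𝕜) (p : Fin n × Fin n) => M p.1 p.2 :=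
    continuous_pi fun p => continuous_id.matrix_elem p.1 p.2
  refine ⟨isOpen_ne_fun (P.continuous_eval.comp hcont) continuous_const, ?_⟩
  have hsymm : Continuous fun x : Fin n × Fin n → 𝕜 => Matrix.of fun i j => x (i, j) :=
    continuous_matrix fun i j => continuous_apply (i, j)
  have hsurj : Function.Surjective
      fun x : Fin n × Fin n → 𝕜 => Matrix.of fun i j => x (i, j) :=
    fun M => ⟨fun p => M p.1 p.2, rfl⟩
  refine (hsurj.denseRange.dense_image hsymm
    (dense_setOf_mvPolynomial_eval_ne_zero P ((hP D).2 hD))).mono ?_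
  rintro _ ⟨x, hx, rfl⟩
  exact hx

/-- Varying one factor of a product of invertible elements amounts to multiplying that factor by
fixed units on both sides. -/
theorem exists_isUnit_prod_ofFn_update {R : Type*} [Monoid R] {k : ℕ} (g : Fin k → R)
    (hg : ∀ i, IsUnit (g i)) (j : Fin k) :
    ∃ U V : R, IsUnit U ∧ IsUnit V ∧
      ∀ x, (List.ofFn (Function.update g j x)).prod = U * x * V := by
  have hmem : ∀ x ∈ List.ofFn g, IsUnit x := by
    simpa [List.mem_ofFn] using hg
  refine ⟨((List.ofFn g).take j).prod, ((List.ofFn g).drop (j + 1)).prod,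
    List.prod_isUnit fun x hx => hmem x (List.mem_of_mem_take hx),
    List.prod_isUnit fun x hx => hmem x (List.mem_of_mem_drop hx), fun x => ?_⟩
  have hset : List.ofFn (Function.update g j x) = (List.ofFn g).set j x := by
    refine List.ext_getElem (by simp) fun i h₁ h₂ => ?_
    simp [List.getElem_set, Function.update_apply, Fin.ext_iff, eq_comm]
  rw [hset, List.prod_set]
  simp

theorem exists_simpleSpectrum_tuple_of_openMap {𝕜 : Type*} [RCLike 𝕜] (n k : ℕ) (hk : 1 ≤ k)
    (f : Fin k →
      ({M : Matrix (Fin n) (Fin n) 𝕜 // IsUnit M} → {M : Matrix (Fin n) (Fin n) 𝕜 // IsUnit M}))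
    (hf : ∃ i, IsOpenMap (f i))
    (A : Fin k → Matrix (Fin n) (Fin n) 𝕜) (ε : ℝ) (hε : 0 < ε) :
    ∃ Aε : Fin k → {M : Matrix (Fin n) (Fin n) 𝕜 // IsUnit M},
      (∀ i, Squarefree (Aε i : Matrix (Fin n) (Fin n) 𝕜).charpoly) ∧
      (∀ i, ‖A i - (Aε i : Matrix (Fin n) (Fin n) 𝕜)‖ < ε) ∧
      Squarefree
        (List.ofFn fun i => (f i (Aε i) : Matrix (Fin n) (Fin n) 𝕜)).prod.charpoly := by
  obtain ⟨j, hj⟩ := hf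
  obtain ⟨hopen, hdense⟩ := isOpen_and_dense_setOf_isUnit_and_squarefree_charpoly 𝕜 n
  have happrox : ∀ i, ∃ B : {M : Matrix (Fin n) (Fin n) 𝕜 // IsUnit M},
      Squarefree B.1.charpoly ∧ ‖A i - B.1‖ < ε := fun i => by
    obtain ⟨M, hM, hMA⟩ := Metric.dense_iff.1 hdense (A i) ε hε
    exact ⟨⟨M, hMA.1⟩, hMA.2, by rwa [← dist_eq_norm, dist_comm]⟩
  choose B hBsq hBnear using happrox
  obtain ⟨U, V, hU, hV, hUV⟩ := exists_isUnit_prod_ofFn_update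
    (fun i => (f i (B i)).1) (fun i => (f i (B i)).2) j
  let O : Set {M : Matrix (Fin n) (Fin n) 𝕜 // IsUnit M} :=
    {M | (IsUnit M.1 ∧ Squarefree M.1.charpoly) ∧ ‖A j - M.1‖ < ε}
  have hO : IsOpen O := (hopen.preimage continuous_subtype_val).inter
    (isOpen_lt (continuous_const.sub continuous_subtype_val).norm continuous_const)
  have hGL : IsOpen {M : Matrix (Fin n) (Fin n) 𝕜 | IsUnit M} := by
    simp_rw [Matrix.isUnit_iff_isUnit_det, isUnit_iff_ne_zero]
    exact isOpen_ne_fun continuous_id.matrix_det continuous_const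
  have hW : IsOpen (Subtype.val '' (f j '' O)) := hGL.isOpenMap_subtype_val _ (hj O hO)
  obtain ⟨u, rfl⟩ := hU
  obtain ⟨v, rfl⟩ := hV
  have hW' : IsOpen ((fun N : Matrix (Fin n) (Fin n) 𝕜 =>
      ((u⁻¹ : (Matrix (Fin n) (Fin n) 𝕜)ˣ) : Matrix (Fin n) (Fin n) 𝕜) * N *
        ((v⁻¹ : (Matrix (Fin n) (Fin n) 𝕜)ˣ) : Matrix (Fin n) (Fin n) 𝕜)) ⁻¹'
      (Subtype.val '' (f j '' O))) :=
    hW.preimage ((continuous_const.matrix_mul continuous_id).matrix_mul continuous_const)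
  obtain ⟨N, ⟨_, ⟨C, hC, rfl⟩, hCN⟩, hN⟩ := hdense.inter_open_nonempty _ hW'
    ⟨u * (f j (B j)).1 * v, f j (B j), ⟨B j, ⟨⟨(B j).2, hBsq j⟩, hBnear j⟩, rfl⟩,
      by simp [mul_assoc]⟩
  refine ⟨Function.update B j C, fun i => ?_, fun i => ?_, ?_⟩
  · obtain rfl | hij := eq_or_ne i j
    · simpa using hC.1.2
    · simpa [hij] using hBsq i
  · obtain rfl | hij := eq_or_ne i j
    · simpa using hC.2
    · simpa [hij] using hBnear i
  · have hupd : (fun i => (f i (Function.update B j C i)).1) =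
        Function.update (fun i => (f i (B i)).1) j (f j C).1 := by
      ext1 i
      obtain rfl | hij := eq_or_ne i j
      · simp
      · simp [hij]
    have hprod : (u : Matrix (Fin n) (Fin n) 𝕜) * (f j C).1 * v = N := by
      rw [hCN]
      simp [mul_assoc]
    rw [hupd, hUV, hprod]
    exact hN.2
end

section
/- (Application to tensor-product binomials) Let 𝔽 = ℝ or ℂ and suppose X ∈ M_{pq}(𝔽) admits a decomposition X = A ⊗ C + B ⊗ D into a sum of two Kronecker products, where A, B ∈ M_p(𝔽) and C, D ∈ M_q(𝔽). Then for any ε > 0 there exist invertible matrices A_ε, B_ε ∈ M_p(𝔽) with simple spectra such that ‖A − A_ε‖ < ε, ‖B − B_ε‖ < ε, the product A_ε·B_ε⁻¹ has a simple spectrum, and the tensor-product binomial X_ε = A_ε ⊗ C + B_ε ⊗ D converges to X as ε → 0; in particular ‖X − X_ε‖ ≤ ε·(‖C‖ + ‖D‖) when the operator norm (or any submultiplicative cross norm satisfying ‖M ⊗ N‖ ≤ ‖M‖·‖N‖) is used. -/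
open Kronecker

attribute [local instance] Matrix.frobeniusNormedAddCommGroup

open Polynomial

theorem Polynomial.eventually_eval_ne_zero_s6 {𝕜 : Type*} [NormedField 𝕜] {P : 𝕜[X]} (hP : P ≠ 0)
    (a : 𝕜) : ∀ᶠ t in nhdsWithin a {a}ᶜ, P.eval t ≠ 0 := by
  refine Filter.Eventually.filter_mono (nhdsNE_le_cofinite a) ?_
  rw [Filter.eventually_cofinite]
  simpa using P.finite_setOfPred_isRoot hP

namespace Matrix

theorem frobenius_norm_kronecker {𝕜 l m n o : Type*} [NormedField 𝕜]
    [Fintype l] [Fintype m] [Fintype n] [Fintype o]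
    (M : Matrix l m 𝕜) (N : Matrix n o 𝕜) : ‖M ⊗ₖ N‖ = ‖M‖ * ‖N‖ := by
  rw [frobenius_norm_def, frobenius_norm_def, frobenius_norm_def,
    ← Real.mul_rpow (by positivity) (by positivity)]
  congr 1
  simp only [kroneckerMap_apply, norm_mul, Fintype.sum_prod_type,
    Real.mul_rpow (norm_nonneg _) (norm_nonneg _), Finset.sum_mul_sum]

variable {n K : Type*} [Fintype n] [DecidableEq n] [Field K]

theorem charpoly_smul {c : K} (hc : c ≠ 0) (M : Matrix n n K) :
    (c • M).charpoly = C (c ^ Fintype.card n) * M.charpoly.comp (C c⁻¹ * X) := by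
  have h_cc : C c * C c⁻¹ = (1 : K[X]) := by rw [← C_mul, mul_inv_cancel₀ hc, C_1]
  have h : (c • M).charmatrix =
      C c • (compRingHom (C c⁻¹ * X)).mapMatrix M.charmatrix := by
    ext1 i j
    by_cases hij : i = j
    · subst hij
      simp [mul_sub, ← mul_assoc, h_cc]
    · simp [hij]
  rw [charpoly, h, det_smul, ← RingHom.map_det, C_pow]
  rfl

theorem separable_charpoly_smul {c : K} (hc : c ≠ 0) {M : Matrix n n K}
    (hM : M.charpoly.Separable) : (c • M).charpoly.Separable := by
  rw [charpoly_smul hc]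
  have hu {a : K} (ha : a ≠ 0) : IsUnit (C a) := isUnit_C.2 ha.isUnit
  refine Separable.unit_mul (hu (pow_ne_zero _ hc)) ?_
  rw [separable_def, derivative_comp, derivative_C_mul, derivative_X, mul_one,
    isCoprime_mul_unit_left_right (hu (inv_ne_zero hc))]
  exact IsCoprime.map hM (compRingHom (C c⁻¹ * X))

theorem separable_charpoly_diagonal {d : n → K} (hd : Function.Injective d) :
    (diagonal d).charpoly.Separable := by
  rw [charpoly_diagonal]
  exact separable_prod_X_sub_C_iff.2 hd

/-- The affine path from `A` to `B`, as a matrix of polynomials in the parameter. -/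
noncomputable def affinePath (A B : Matrix n n K) : Matrix n n K[X] :=
  A.map C + (X : K[X]) • (B - A).map C

theorem map_eval_affinePath (A B : Matrix n n K) (t : K) :
    (evalRingHom t).mapMatrix (affinePath A B) = A + t • (B - A) := by
  ext i j
  simp [affinePath]

theorem map_eval_one_affinePath (A B : Matrix n n K) :
    (evalRingHom 1).mapMatrix (affinePath A B) = B := by
  rw [map_eval_affinePath, one_smul, add_sub_cancel]

theorem eval_resultant_charpoly_ne_zero_iff [CharZero K] (M : Matrix n n K[X]) (t : K) :
    (resultant M.charpoly M.charpoly.derivative).eval t ≠ 0 ↔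
      ((evalRingHom t).mapMatrix M).charpoly.Separable := by
  have h : ((evalRingHom t).mapMatrix M).charpoly = M.charpoly.map (evalRingHom t) :=
    charpoly_map M (evalRingHom t)
  have h₁ : (resultant M.charpoly M.charpoly.derivative).eval t =
      resultant ((evalRingHom t).mapMatrix M).charpoly
        ((evalRingHom t).mapMatrix M).charpoly.derivative := by
    rw [natDegree_derivative, natDegree_derivative, charpoly_natDegree_eq_dim,
      charpoly_natDegree_eq_dim, h, derivative_map, resultant_map_map]
    rfl
  rw [h₁, ← isUnit_iff_ne_zero, isUnit_resultant_iff_isCoprime (charpoly_monic _)]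
  rfl

theorem exists_separable_charpoly_and_mul_self (K : Type*) [Field K] [CharZero K] (p : ℕ) :
    ∃ E : Matrix (Fin p) (Fin p) K,
      E.det ≠ 0 ∧ E.charpoly.Separable ∧ (E * E).charpoly.Separable := by
  refine ⟨diagonal fun i => ((i + 1 : ℕ) : K), ?_, ?_, ?_⟩
  · rw [det_diagonal]
    exact Finset.prod_ne_zero_iff.2 fun i _ => Nat.cast_ne_zero.2 i.val.succ_ne_zero
  · exact separable_charpoly_diagonal fun i j hij => by simpa [Fin.ext_iff] using hij
  · rw [diagonal_mul_diagonal]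
    refine separable_charpoly_diagonal fun i j hij => ?_
    have h : ((i : ℕ) + 1) * (i + 1) = ((j : ℕ) + 1) * (j + 1) := by exact_mod_cast hij
    exact Fin.ext (by simpa using Nat.mul_self_inj.1 h)

section Eventually

variable {𝕜 : Type*} [NormedField 𝕜]

theorem eventually_det_ne_zero {M : Matrix n n 𝕜[X]} {s : 𝕜}
    (h : ((evalRingHom s).mapMatrix M).det ≠ 0) (a : 𝕜) :
    ∀ᶠ t in nhdsWithin a {a}ᶜ, ((evalRingHom t).mapMatrix M).det ≠ 0 := by
  simp_rw [← RingHom.map_det] at h ⊢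
  refine Polynomial.eventually_eval_ne_zero_s6 (fun hM => h ?_) a
  rw [hM, map_zero]

theorem eventually_separable_charpoly [CharZero 𝕜] {M : Matrix n n 𝕜[X]} {s : 𝕜}
    (h : ((evalRingHom s).mapMatrix M).charpoly.Separable) (a : 𝕜) :
    ∀ᶠ t in nhdsWithin a {a}ᶜ, ((evalRingHom t).mapMatrix M).charpoly.Separable := by
  simp_rw [← eval_resultant_charpoly_ne_zero_iff] at h ⊢
  refine Polynomial.eventually_eval_ne_zero_s6 (fun hM => h ?_) a
  rw [hM, eval_zero]

theorem eventually_norm_smul_lt {l m : Type*} [Fintype l] [Fintype m] (M : Matrix l m 𝕜)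
    {ε : ℝ} (hε : 0 < ε) : ∀ᶠ t : 𝕜 in nhdsWithin 0 {0}ᶜ, ‖t • M‖ < ε := by
  have := frobeniusNormSMulClass (m := l) (n := m) (R := 𝕜) (α := 𝕜)
  simp_rw [norm_smul]
  have hc : Continuous fun t : 𝕜 => ‖t‖ * ‖M‖ := by fun_prop
  exact (hc.tendsto' 0 0 (by simp)).eventually_lt_const hε |>.filter_mono nhdsWithin_le_nhds

end Eventually

theorem exists_simpleSpectrum_approx {𝕜 : Type*} [NontriviallyNormedField 𝕜] [CharZero 𝕜]
    {p : ℕ} (A B : Matrix (Fin p) (Fin p) 𝕜) {ε : ℝ} (hε : 0 < ε) :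
    ∃ A' B' : Matrix (Fin p) (Fin p) 𝕜, A'.det ≠ 0 ∧ B'.det ≠ 0 ∧
      A'.charpoly.Separable ∧ B'.charpoly.Separable ∧ ‖A - A'‖ < ε ∧ ‖B - B'‖ < ε ∧
      (A' * B'⁻¹).charpoly.Separable := by
  obtain ⟨E, hdet, hE, hEE⟩ := exists_separable_charpoly_and_mul_self 𝕜 p
  have hadj : ((evalRingHom 1).mapMatrix
      (affinePath A (E * E) * (affinePath B E).adjugate)).charpoly.Separable := by
    rw [map_mul, RingHom.map_adjugate, map_eval_one_affinePath, map_eval_one_affinePath,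
      mul_assoc, mul_adjugate, mul_smul_comm, mul_one]
    exact separable_charpoly_smul hdet hE
  have hdetA : ((evalRingHom 1).mapMatrix (affinePath A (E * E))).det ≠ 0 := by
    rw [map_eval_one_affinePath, det_mul]
    exact mul_ne_zero hdet hdet
  rw [← map_eval_one_affinePath B E] at hdet hE
  rw [← map_eval_one_affinePath A (E * E)] at hEE
  obtain ⟨t, h₁, h₂, h₃, h₄, h₅, h₆, h₇⟩ :=
    ((eventually_det_ne_zero hdetA 0).and <| (eventually_det_ne_zero hdet 0).and <|
      (eventually_separable_charpoly hEE 0).and <| (eventually_separable_charpoly hE 0).and <|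
      (eventually_separable_charpoly hadj 0).and <|
      (eventually_norm_smul_lt (E * E - A) hε).and (eventually_norm_smul_lt (E - B) hε)).exists
  rw [map_mul, RingHom.map_adjugate] at h₅
  rw [map_eval_affinePath] at h₁ h₂ h₃ h₄
  rw [map_eval_affinePath, map_eval_affinePath] at h₅
  refine ⟨_, _, h₁, h₂, h₃, h₄, ?_, ?_, ?_⟩
  · rwa [sub_add_cancel_left, norm_neg]
  · rwa [sub_add_cancel_left, norm_neg]
  · rw [inv_def, mul_smul_comm, Ring.inverse_eq_inv']
    exact separable_charpoly_smul (inv_ne_zero h₂) h₅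

end Matrix

/-- Application to tensor-product binomials: if `X = A ⊗ C + B ⊗ D` is a sum of two
Kronecker products, then for any `ε > 0` the factors `A, B` can be `ε`-approximated by
invertible matrices `Aε, Bε` with simple spectra such that `Aε * Bε⁻¹` has a simple
spectrum and the binomial `Xε = Aε ⊗ C + Bε ⊗ D` satisfies `‖X - Xε‖ ≤ ε * (‖C‖ + ‖D‖)`
(here the Frobenius norm, a cross norm with `‖M ⊗ N‖ ≤ ‖M‖ * ‖N‖`, is used). -/
theorem exists_simpleSpectrum_kronecker_binomial_approx {𝕜 : Type*} [RCLike 𝕜] (p q : ℕ)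
    (A B : Matrix (Fin p) (Fin p) 𝕜) (C D : Matrix (Fin q) (Fin q) 𝕜)
    (X : Matrix (Fin p × Fin q) (Fin p × Fin q) 𝕜)
    (hX : X = A ⊗ₖ C + B ⊗ₖ D) (ε : ℝ) (hε : 0 < ε) :
    ∃ Aε Bε : Matrix (Fin p) (Fin p) 𝕜,
      IsUnit Aε ∧ IsUnit Bε ∧
      Squarefree Aε.charpoly ∧ Squarefree Bε.charpoly ∧
      ‖A - Aε‖ < ε ∧ ‖B - Bε‖ < ε ∧
      Squarefree (Aε * Bε⁻¹).charpoly ∧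
      ‖X - (Aε ⊗ₖ C + Bε ⊗ₖ D)‖ ≤ ε * (‖C‖ + ‖D‖) := by
  obtain ⟨A', B', hA', hB', hA, hB, hAA', hBB', hAB⟩ :=
    Matrix.exists_simpleSpectrum_approx A B hε
  refine ⟨A', B', (Matrix.isUnit_iff_isUnit_det _).2 hA'.isUnit,
    (Matrix.isUnit_iff_isUnit_det _).2 hB'.isUnit, hA.squarefree, hB.squarefree, hAA', hBB',
    hAB.squarefree, ?_⟩
  have h : X - (A' ⊗ₖ C + B' ⊗ₖ D) = (A - A') ⊗ₖ C + (B - B') ⊗ₖ D := by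
    rw [hX]
    ext i j
    simp only [Matrix.sub_apply, Matrix.add_apply, Matrix.kroneckerMap_apply]
    ring
  rw [h, mul_add]
  refine (norm_add_le _ _).trans ?_
  rw [Matrix.frobenius_norm_kronecker, Matrix.frobenius_norm_kronecker]
  gcongr
end
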